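/- Let m ∈ ℝ and 0 < q ≤ ∞. A smooth function σ on ℝ^{2d} belongs to S^m(ℝ^{2d}) if and only if σ ∈ M^{∞,q}_{⟨·⟩^{−m} ⊗ ⟨·⟩^s}(ℝ^{2d}) for every s ≥ 0; that is, S^m(ℝ^{2d}) = ⋂_{s≥0} M^{∞,q}_{⟨·⟩^{−m}⊗⟨·⟩^s}(ℝ^{2d}). -/

import Mathlib

open scoped Real BigOperators
open Complex MeasureTheory

noncomputable section

variable {d : ℕ}

/-- The Japanese bracket on phase space `ℝ^{2d} = ℝ^d × ℝ^d` (Euclidean norm). -/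
def jb2 (w : (Fin d → ℝ) × (Fin d → ℝ)) : ℝ :=
  Real.sqrt (1 + ∑ i, (w.1 i) ^ 2 + ∑ i, (w.2 i) ^ 2)

/-- Directional derivative operator. -/
def pdir {E : Type*} [NormedAddCommGroup E] [NormedSpace ℝ E] (v : E) (h : E → ℂ) : E → ℂ :=
  fun y => fderiv ℝ h y v

/-- Iterated directional derivatives along a list of directions. -/
def mpdList {E : Type*} [NormedAddCommGroup E] [NormedSpace ℝ E]
    (vs : List E) (h : E → ℂ) : E → ℂ :=
  vs.foldr pdir h

/-- The list of coordinate directions encoding the multi-index `α`. -/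
def stdList (d : ℕ) (α : Fin d → ℕ) : List (Fin d → ℝ) :=
  (List.finRange d).flatMap fun i => List.replicate (α i) (Pi.single i 1)

/-- Directions on phase space encoding a multi-index on `ℝ^{2d}`. -/
def stdList2 (d : ℕ) (α : (Fin d → ℕ) × (Fin d → ℕ)) :
    List ((Fin d → ℝ) × (Fin d → ℝ)) :=
  ((stdList d α.1).map fun v => (v, 0)) ++ ((stdList d α.2).map fun v => (0, v))

/-- The multi-index partial derivative `∂^α` on phase space. -/
def mpd2 (α : (Fin d → ℕ) × (Fin d → ℕ)) (h : (Fin d → ℝ) × (Fin d → ℝ) → ℂ) :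
    (Fin d → ℝ) × (Fin d → ℝ) → ℂ :=
  mpdList (stdList2 d α) h

/-- The short-time Fourier transform on phase space:
`V_G σ(x,ω) = ∫ e^{-2πi ω·p} σ(p) conj(G(p-x)) dp`. -/
def stft2 (G σ : (Fin d → ℝ) × (Fin d → ℝ) → ℂ)
    (x ω : (Fin d → ℝ) × (Fin d → ℝ)) : ℂ :=
  ∫ p : (Fin d → ℝ) × (Fin d → ℝ),
    Complex.exp (-(2 * π * Complex.I *
        (∑ i, ω.1 i * p.1 i + ∑ i, ω.2 i * p.2 i))) * σ p *
      (starRingEnd ℂ) (G (p - x))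

open scoped ENNReal in
/-- The modulation space (quasi-)norm of `M^{∞,q}_{⟨·⟩^{-m} ⊗ ⟨·⟩^s}(ℝ^{2d})`,
for `0 < q ≤ ∞` encoded as `q : ℝ≥0∞`. -/
def modNorm (q : ℝ≥0∞) (m s : ℝ) (G σ : (Fin d → ℝ) × (Fin d → ℝ) → ℂ) : ℝ≥0∞ :=
  if q = ∞ then
    ⨆ ω, ⨆ x, (‖stft2 G σ x ω‖₊ : ℝ≥0∞) * ENNReal.ofReal (jb2 x ^ (-m)) *
      ENNReal.ofReal (jb2 ω ^ s)
  else
    (∫⁻ ω : (Fin d → ℝ) × (Fin d → ℝ),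
        (⨆ x, (‖stft2 G σ x ω‖₊ : ℝ≥0∞) * ENNReal.ofReal (jb2 x ^ (-m))) ^ q.toReal *
          ENNReal.ofReal (jb2 ω ^ s) ^ q.toReal) ^ (1 / q.toReal)

open scoped FourierTransform SchwartzMap InnerProductSpace ENNReal
open Module (finrank)

section LocalFourier

/-- The Japanese bracket `⟨z⟩ = (1 + |z|²)^{1/2}` on a normed space. -/
def japBracket {V : Type*} [NormedAddCommGroup V] (z : V) : ℝ := √(1 + ‖z‖ ^ 2)

/-- A positive weight is moderate of order `κ` if translation by `y` changes it by a factor of at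
most `(1 + |y|)^κ`. -/
structure IsModerate {V : Type*} [NormedAddCommGroup V] (u : V → ℝ) (κ : ℕ) : Prop where
  pos : ∀ x, 0 < u x
  add_le : ∀ x y, u (x + y) ≤ u x * (1 + ‖y‖) ^ κ

section Weights

variable {V : Type*} [NormedAddCommGroup V]

lemma one_le_japBracket (z : V) : 1 ≤ japBracket z := by
  rw [japBracket, Real.one_le_sqrt]
  nlinarith [sq_nonneg ‖z‖]

lemma japBracket_pos (z : V) : 0 < japBracket z := one_pos.trans_le (one_le_japBracket z)

lemma japBracket_le_one_add_norm (z : V) : japBracket z ≤ 1 + ‖z‖ := by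
  rw [japBracket, Real.sqrt_le_left (by positivity)]
  nlinarith [norm_nonneg z]

lemma norm_le_japBracket (z : V) : ‖z‖ ≤ japBracket z :=
  Real.le_sqrt_of_sq_le (by linarith)

lemma japBracket_add_le (x y : V) : japBracket (x + y) ≤ japBracket x * (1 + ‖y‖) := by
  have h1 := one_le_japBracket x
  have h2 : japBracket x ^ 2 = 1 + ‖x‖ ^ 2 := Real.sq_sqrt (by positivity)
  have h3 := norm_le_japBracket x
  have h4 : japBracket (x + y) ≤ japBracket x + ‖y‖ := by
    rw [japBracket, Real.sqrt_le_left (by positivity)]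
    have := norm_add_le x y
    nlinarith [norm_nonneg x, norm_nonneg y, norm_nonneg (x + y)]
  nlinarith [norm_nonneg y]

lemma isModerate_japBracket_rpow (m : ℝ) :
    IsModerate (fun x : V => japBracket x ^ m) ⌈|m|⌉₊ where
  pos x := Real.rpow_pos_of_pos (japBracket_pos x) m
  add_le x y := by
    have hy : 1 ≤ 1 + ‖y‖ := by linarith [norm_nonneg y]
    have key : japBracket (x + y) ^ m ≤ japBracket x ^ m * (1 + ‖y‖) ^ |m| := by
      rcases le_total 0 m with hm | hm
      · rw [abs_of_nonneg hm, ← Real.mul_rpow (japBracket_pos x).le (by positivity)]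
        exact Real.rpow_le_rpow (japBracket_pos _).le (japBracket_add_le x y) hm
      · rw [abs_of_nonpos hm, Real.rpow_neg (by positivity), ← div_eq_mul_inv,
          ← Real.div_rpow (japBracket_pos x).le (by positivity)]
        refine Real.rpow_le_rpow_of_nonpos (div_pos (japBracket_pos x) (by positivity)) ?_ hm
        rw [div_le_iff₀ (by positivity)]
        simpa using japBracket_add_le (x + y) (-y)
    refine key.trans ?_
    rw [← Real.rpow_natCast]
    have := japBracket_pos x
    gcongr
    exact Nat.le_ceil _

/-- The weights `⟨x⟩^m (1 + ε⟨x⟩)^K` are moderate, uniformly in `ε`. -/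
lemma IsModerate.mul_one_add_pow {u : V → ℝ} {κ : ℕ} (hu : IsModerate u κ) (K : ℕ) {ε : ℝ}
    (hε : 0 ≤ ε) : IsModerate (fun x => u x * (1 + ε * japBracket x) ^ K) (κ + K) where
  pos x := by
    have := japBracket_pos x
    have := hu.pos x
    positivity
  add_le x y := by
    have h1 := japBracket_pos x
    have h2 := hu.pos x
    have h3 := japBracket_pos (x + y)
    have h4 : 1 + ε * japBracket (x + y) ≤ (1 + ε * japBracket x) * (1 + ‖y‖) := by
      nlinarith [mul_le_mul_of_nonneg_left (japBracket_add_le x y) hε, norm_nonneg y]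
    calc u (x + y) * (1 + ε * japBracket (x + y)) ^ K
        ≤ (u x * (1 + ‖y‖) ^ κ) * ((1 + ε * japBracket x) * (1 + ‖y‖)) ^ K := by
          have := hu.add_le x y
          gcongr
      _ = _ := by
          rw [mul_pow, pow_add]
          ring

end Weights

variable {V : Type*} [NormedAddCommGroup V] [InnerProductSpace ℝ V]

/-- The translate of `f` by `-x`, localized by the window `H`. -/
def localized (f : V → ℂ) (H : 𝓢(V, ℂ)) (x y : V) : ℂ := f (x + y) * H y

lemma ContDiff.localized {f : V → ℂ} {n : ℕ∞} (hf : ContDiff ℝ n f) (H : 𝓢(V, ℂ)) (x : V) :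
    ContDiff ℝ n (localized f H x) :=
  (hf.comp (contDiff_const.add contDiff_id)).mul (H.smooth n)

lemma Continuous.localized {f : V → ℂ} (hf : Continuous f) (H : 𝓢(V, ℂ)) (x : V) :
    Continuous (localized f H x) :=
  (hf.comp (continuous_const.add continuous_id)).mul H.continuous

lemma norm_localized_le {f : V → ℂ} {u : V → ℝ} {κ : ℕ} (hu : IsModerate u κ) {S : ℝ}
    (hS : 0 ≤ S) (hf : ∀ z, ‖f z‖ ≤ S * u z) (H : 𝓢(V, ℂ)) (x y : V) :
    ‖localized f H x y‖ ≤ S * u x * ((1 + ‖y‖) ^ κ * ‖H y‖) := by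
  rw [_root_.localized, norm_mul]
  calc ‖f (x + y)‖ * ‖H y‖ ≤ S * (u x * (1 + ‖y‖) ^ κ) * ‖H y‖ := by
        gcongr
        exact (hf _).trans (mul_le_mul_of_nonneg_left (hu.add_le x y) hS)
    _ = _ := by ring

open LineDeriv in
lemma pdir_localized {f : V → ℂ} (hf : Differentiable ℝ f) (H : 𝓢(V, ℂ)) (x v : V) :
    pdir v (localized f H x) = localized (pdir v f) H x + localized f (∂_{v} H) x := by
  ext y
  have h1 : HasFDerivAt (fun y => f (x + y)) (fderiv ℝ f (x + y)) y := by
    exact (hf (x + y)).hasFDerivAt.comp y ((hasFDerivAt_id y).const_add x)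
  have h2 := h1.mul (H.differentiableAt (x := y)).hasFDerivAt
  have h3 : fderiv ℝ (localized f H x) y = _ := h2.fderiv
  simp only [pdir, h3, Pi.add_apply, _root_.localized, SchwartzMap.lineDerivOp_apply_eq_fderiv]
  simp
  ring

lemma one_add_norm_pow_le {ι : Type*} [Fintype ι] (b : OrthonormalBasis ι ℝ V) (N : ℕ) (ω : V) :
    (1 + ‖ω‖) ^ (N + 1) ≤
      ((Fintype.card ι : ℝ) + 1) ^ N * (1 + ∑ i, |⟪b i, ω⟫_ℝ| ^ (N + 1)) := by
  have h1 : ‖ω‖ ≤ ∑ i, |⟪b i, ω⟫_ℝ| := by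
    calc ‖ω‖ = ‖∑ i, ⟪b i, ω⟫_ℝ • b i‖ := by rw [b.sum_repr']
      _ ≤ ∑ i, ‖⟪b i, ω⟫_ℝ • b i‖ := norm_sum_le _ _
      _ = _ := by simp [norm_smul]
  have h3 := pow_sum_le_card_mul_sum_pow (s := (Finset.univ : Finset (Option ι)))
    (f := fun i => i.elim 1 fun i => |⟪b i, ω⟫_ℝ|) (by
      rintro (_ | i) -
      · simp
      · simp) N
  rw [Fintype.sum_option, Fintype.sum_option] at h3
  simp only [Option.elim_none, Option.elim_some, one_pow, Finset.card_univ, Fintype.card_option,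
    Nat.cast_add, Nat.cast_one] at h3
  exact (pow_le_pow_left₀ (by positivity) (by linarith) _).trans h3

variable [FiniteDimensional ℝ V] [MeasurableSpace V] [BorelSpace V]

lemma SchwartzMap.integrable_one_add_norm_pow_mul (H : 𝓢(V, ℂ)) (k : ℕ) :
    Integrable fun y => (1 + ‖y‖) ^ k * ‖H y‖ := by
  have : (fun y => (1 + ‖y‖) ^ k * ‖H y‖) =
      fun y => ∑ j ∈ Finset.range (k + 1), (k.choose j : ℝ) * (‖y‖ ^ (k - j) * ‖H y‖) := by
    ext y
    rw [add_pow, Finset.sum_mul]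
    exact Finset.sum_congr rfl fun j _ => by ring
  rw [this]
  exact integrable_finsetSum _ fun j _ => (H.integrable_pow_mul volume (k - j)).const_mul _

lemma integrable_localized {f : V → ℂ} (hfc : Continuous f) {u : V → ℝ} {κ : ℕ}
    (hu : IsModerate u κ) {S : ℝ} (hS : 0 ≤ S) (hf : ∀ z, ‖f z‖ ≤ S * u z) (H : 𝓢(V, ℂ)) (x : V) :
    Integrable (localized f H x) :=
  ((H.integrable_one_add_norm_pow_mul κ).const_mul (S * u x)).mono'
    (hfc.localized H x).aestronglyMeasurable
    (Filter.Eventually.of_forall (norm_localized_le hu hS hf H x))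

lemma norm_fourier_localized_le {f : V → ℂ} {u : V → ℝ} {κ : ℕ}
    (hu : IsModerate u κ) {S : ℝ} (hS : 0 ≤ S) (hf : ∀ z, ‖f z‖ ≤ S * u z) (H : 𝓢(V, ℂ))
    (x ω : V) :
    ‖𝓕 (localized f H x) ω‖ ≤ S * u x * ∫ y, (1 + ‖y‖) ^ κ * ‖H y‖ := by
  rw [Real.fourier_eq, ← integral_const_mul]
  refine norm_integral_le_of_norm_le ((H.integrable_one_add_norm_pow_mul κ).const_mul _)
    (Filter.Eventually.of_forall fun y => ?_)
  rw [Circle.norm_smul]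
  exact norm_localized_le hu hS hf H x y

lemma norm_fourier_localized_sub_le {f : V → ℂ} (hfc : Continuous f) {u : V → ℝ} {κ : ℕ}
    (hu : IsModerate u κ) {S : ℝ} (hS : 0 ≤ S) (hf : ∀ z, ‖f z‖ ≤ S * u z) (H : 𝓢(V, ℂ))
    (x ω ω' : V) :
    ‖𝓕 (localized f H x) ω - 𝓕 (localized f H x) ω'‖ ≤
      2 * π * (S * u x * ∫ y, (1 + ‖y‖) ^ (κ + 1) * ‖H y‖) * ‖ω - ω'‖ := by
  have hi := integrable_localized hfc hu hS hf H x
  rw [Real.fourier_eq, Real.fourier_eq, ← integral_sub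
    ((Real.fourierIntegral_convergent_iff ω).2 hi) ((Real.fourierIntegral_convergent_iff ω').2 hi)]
  calc _ ≤ ∫ y, (2 * π * (S * u x) * ‖ω - ω'‖) * ((1 + ‖y‖) ^ (κ + 1) * ‖H y‖) := by
        refine norm_integral_le_of_norm_le ((H.integrable_one_add_norm_pow_mul _).const_mul _)
          (Filter.Eventually.of_forall fun y => ?_)
        have hc : ‖((𝐞 (-⟪y, ω⟫_ℝ) : Circle) : ℂ) - 𝐞 (-⟪y, ω'⟫_ℝ)‖ ≤ 2 * π * (‖y‖ * ‖ω - ω'‖) := by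
          have e : ((𝐞 (-⟪y, ω⟫_ℝ) : Circle) : ℂ) - 𝐞 (-⟪y, ω'⟫_ℝ) =
              𝐞 (-⟪y, ω'⟫_ℝ) * (Complex.exp (Complex.I * (2 * π * (-⟪y, ω - ω'⟫_ℝ) : ℝ)) - 1) := by
            rw [mul_sub, mul_one, Real.fourierChar_apply, Real.fourierChar_apply,
              ← Complex.exp_add, inner_sub_right]
            congr 2
            push_cast
            ring
          rw [e, norm_mul, Circle.norm_coe, one_mul]
          refine (Real.norm_exp_I_mul_ofReal_sub_one_le).trans ?_
          rw [norm_mul, norm_neg, Real.norm_of_nonneg (by positivity : 0 ≤ 2 * π)]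
          have := norm_inner_le_norm (𝕜 := ℝ) y (ω - ω')
          gcongr
        have h1 := norm_localized_le hu hS hf H x y
        rw [Circle.smul_def, Circle.smul_def, ← sub_smul, norm_smul]
        have hux := hu.pos x
        calc _ ≤ (2 * π * (‖y‖ * ‖ω - ω'‖)) * (S * u x * ((1 + ‖y‖) ^ κ * ‖H y‖)) := by gcongr
          _ ≤ (2 * π * ((1 + ‖y‖) * ‖ω - ω'‖)) * (S * u x * ((1 + ‖y‖) ^ κ * ‖H y‖)) := by
            gcongr
            linarith
          _ = _ := by ring
    _ = _ := by rw [integral_const_mul]; ring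

/-- The short-time Fourier transform of `f` with window `H` decays rapidly in frequency, uniformly
with respect to the weight `u` in space. -/
def RapidDecay (f : V → ℂ) (H : 𝓢(V, ℂ)) (u : V → ℝ) : Prop :=
  ∀ N : ℕ, ∃ C : ℝ, ∀ x ω, (1 + ‖ω‖) ^ N * ‖𝓕 (localized f H x) ω‖ ≤ C * u x

section Forward

lemma fourier_pdir {g : V → ℂ} (hg : Differentiable ℝ g) (hgi : Integrable g) {v : V}
    (hgi' : Integrable (pdir v g)) (ω : V) :
    𝓕 (pdir v g) ω = 2 * π * Complex.I * ⟪v, ω⟫_ℝ * 𝓕 g ω := by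
  have he (y : V) : HasFDerivAt (fun y : V => ((𝐞 (-⟪y, ω⟫_ℝ) : Circle) : ℂ))
      (-(2 * π * Complex.I * 𝐞 (-⟪y, ω⟫_ℝ)) • (Complex.ofRealCLM ∘L (innerSL ℝ ω))) y := by
    have h1 : HasFDerivAt (fun y : V => ⟪y, ω⟫_ℝ) (innerSL ℝ ω) y := by
      simpa [real_inner_comm] using (innerSL ℝ ω).hasFDerivAt (x := y)
    have h2 := (Complex.ofRealCLM.hasFDerivAt.comp y h1).const_mul (-(2 * π * Complex.I))
    have h3 := h2.cexp
    have e (y : V) : ((𝐞 (-⟪y, ω⟫_ℝ) : Circle) : ℂ) =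
        Complex.exp (-(2 * π * Complex.I) * (Complex.ofRealCLM ∘ fun y : V => ⟪y, ω⟫_ℝ) y) := by
      rw [Real.fourierChar_apply]
      simp only [Function.comp_apply, Complex.ofRealCLM_apply]
      congr 1
      push_cast
      ring
    simp_rw [e]
    convert h3 using 1
    ext z
    simp
    ring
  have hint {h : V → ℂ} (hh : Integrable h) :
      Integrable fun y => h y * ((𝐞 (-⟪y, ω⟫_ℝ) : Circle) : ℂ) := by
    simpa only [Circle.smul_def, smul_eq_mul, mul_comm] using
      (Real.fourierIntegral_convergent_iff ω).2 hh
  have hder (y : V) : fderiv ℝ (fun y : V => ((𝐞 (-⟪y, ω⟫_ℝ) : Circle) : ℂ)) y v =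
      -(2 * π * Complex.I * ⟪v, ω⟫_ℝ) * 𝐞 (-⟪y, ω⟫_ℝ) := by
    rw [(he y).fderiv]
    simp [real_inner_comm]
    ring
  have key := integral_mul_fderiv_eq_neg_fderiv_mul_of_integrable (μ := volume) (v := v)
    (f := g) (g := fun y : V => ((𝐞 (-⟪y, ω⟫_ℝ) : Circle) : ℂ)) (hint hgi')
    (by
      simp_rw [hder]
      convert (hint hgi).const_mul (-(2 * π * Complex.I * ⟪v, ω⟫_ℝ)) using 2
      ring) (hint hgi) (fun x _ => hg x) (fun x _ => (he x).differentiableAt)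
  simp_rw [hder] at key
  rw [Real.fourier_eq, Real.fourier_eq]
  simp only [Circle.smul_def, smul_eq_mul]
  have e1 : ∫ y, ((𝐞 (-⟪y, ω⟫_ℝ) : Circle) : ℂ) * pdir v g y =
      ∫ y, fderiv ℝ g y v * 𝐞 (-⟪y, ω⟫_ℝ) := by
    simp only [pdir, mul_comm]
  rw [e1, ← neg_eq_iff_eq_neg.2 key, ← integral_neg, ← integral_const_mul]
  congr 1
  ext y
  ring

open LineDeriv in
lemma exists_inner_pow_mul_fourier_localized_le {u : V → ℝ} {κ : ℕ} (hu : IsModerate u κ) (v : V)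
    (N : ℕ) : ∀ (f : V → ℂ) (H : 𝓢(V, ℂ)), ContDiff ℝ (⊤ : ℕ∞) f →
      (∀ k, ∃ C : ℝ, ∀ z, ‖(pdir v)^[k] f z‖ ≤ C * u z) →
      ∃ C : ℝ, ∀ x ω, |⟪v, ω⟫_ℝ| ^ N * ‖𝓕 (localized f H x) ω‖ ≤ C * u x := by
  have nonneg {f : V → ℂ} {C : ℝ} (h : ∀ z, ‖f z‖ ≤ C * u z) : 0 ≤ C :=
    nonneg_of_mul_nonneg_left ((norm_nonneg _).trans (h 0)) (hu.pos 0)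
  induction N with
  | zero =>
    intro f H hf hbd
    obtain ⟨C, hC⟩ := hbd 0
    refine ⟨C * ∫ y, (1 + ‖y‖) ^ κ * ‖H y‖, fun x ω => ?_⟩
    rw [pow_zero, one_mul, mul_right_comm]
    exact norm_fourier_localized_le hu (nonneg hC) hC H x ω
  | succ N ih =>
    intro f H hf hbd
    have hf' : ContDiff ℝ (⊤ : ℕ∞) (pdir v f) :=
      (hf.fderiv_right (m := (⊤ : ℕ∞)) (by simp)).clm_apply contDiff_const
    obtain ⟨C₁, h₁⟩ := ih (pdir v f) H hf' fun k => hbd (k + 1)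
    obtain ⟨C₂, h₂⟩ := ih f (∂_{v} H) hf hbd
    obtain ⟨B₀, hB₀⟩ := hbd 0
    obtain ⟨B₁, hB₁⟩ := hbd 1
    refine ⟨C₁ + C₂, fun x ω => ?_⟩
    have hfd : Differentiable ℝ f := hf.differentiable (by simp)
    have i₁ := integrable_localized hf'.continuous hu (nonneg hB₁) hB₁ H x
    have i₂ := integrable_localized hf.continuous hu (nonneg hB₀) hB₀ (∂_{v} H) x
    have i₀ := integrable_localized hf.continuous hu (nonneg hB₀) hB₀ H x
    have hp := pdir_localized hfd H x v
    have hF := fourier_pdir (v := v) ((hf.localized H x).differentiable (by simp)) i₀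
      (hp ▸ i₁.add i₂) ω
    have hadd : 𝓕 (localized (pdir v f) H x + localized f (∂_{v} H) x) ω =
        𝓕 (localized (pdir v f) H x) ω + 𝓕 (localized f (∂_{v} H) x) ω := by
      simp only [Real.fourier_eq, Pi.add_apply, smul_add]
      exact integral_add ((Real.fourierIntegral_convergent_iff ω).2 i₁)
        ((Real.fourierIntegral_convergent_iff ω).2 i₂)
    rw [hp, hadd] at hF
    have hn : 2 * π * (|⟪v, ω⟫_ℝ| * ‖𝓕 (localized f H x) ω‖) ≤
        ‖𝓕 (localized (pdir v f) H x) ω‖ + ‖𝓕 (localized f (∂_{v} H) x) ω‖ := by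
      have := (congrArg norm hF).symm.trans_le (norm_add_le _ _)
      simpa [abs_of_pos Real.pi_pos, mul_assoc] using this
    have hpi : 1 ≤ 2 * π := by linarith [Real.pi_gt_three]
    have hn' : |⟪v, ω⟫_ℝ| * ‖𝓕 (localized f H x) ω‖ ≤
        ‖𝓕 (localized (pdir v f) H x) ω‖ + ‖𝓕 (localized f (∂_{v} H) x) ω‖ :=
      (le_mul_of_one_le_left (by positivity) hpi).trans hn
    calc _ = |⟪v, ω⟫_ℝ| ^ N * (|⟪v, ω⟫_ℝ| * ‖𝓕 (localized f H x) ω‖) := by ring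
      _ ≤ |⟪v, ω⟫_ℝ| ^ N *
          (‖𝓕 (localized (pdir v f) H x) ω‖ + ‖𝓕 (localized f (∂_{v} H) x) ω‖) := by gcongr
      _ ≤ (C₁ + C₂) * u x := by
        rw [mul_add, add_mul]
        exact add_le_add (h₁ x ω) (h₂ x ω)

lemma rapidDecay_of_pdir_bounds {ι : Type*} [Fintype ι] (b : OrthonormalBasis ι ℝ V)
    {u : V → ℝ} {κ : ℕ} (hu : IsModerate u κ) {f : V → ℂ} (hf : ContDiff ℝ (⊤ : ℕ∞) f)
    (hbd : ∀ i k, ∃ C : ℝ, ∀ z, ‖(pdir (b i))^[k] f z‖ ≤ C * u z)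
    (hbd₀ : ∃ C : ℝ, ∀ z, ‖f z‖ ≤ C * u z) (H : 𝓢(V, ℂ)) :
    RapidDecay f H u := by
  intro N
  choose C hC using fun i =>
    exists_inner_pow_mul_fourier_localized_le hu (b i) (N + 1) f H hf (hbd i)
  obtain ⟨C₀, hC₀⟩ := exists_inner_pow_mul_fourier_localized_le hu 0 0 f H hf fun k => by
    rcases k with _ | k
    · exact hbd₀
    · refine ⟨0, fun z => ?_⟩
      rw [Function.iterate_succ_apply']
      simp [pdir]
  refine ⟨((Fintype.card ι : ℝ) + 1) ^ N * (C₀ + ∑ i, C i), fun x ω => ?_⟩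
  have h0 := hC₀ x ω
  rw [pow_zero, one_mul] at h0
  calc (1 + ‖ω‖) ^ N * ‖𝓕 (localized f H x) ω‖
      ≤ (1 + ‖ω‖) ^ (N + 1) * ‖𝓕 (localized f H x) ω‖ := by
        gcongr
        · linarith [norm_nonneg ω]
        · exact N.le_succ
    _ ≤ ((Fintype.card ι : ℝ) + 1) ^ N * (1 + ∑ i, |⟪b i, ω⟫_ℝ| ^ (N + 1)) *
          ‖𝓕 (localized f H x) ω‖ := by
        gcongr
        exact one_add_norm_pow_le b N ω
    _ = ((Fintype.card ι : ℝ) + 1) ^ N * (‖𝓕 (localized f H x) ω‖ +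
          ∑ i, |⟪b i, ω⟫_ℝ| ^ (N + 1) * ‖𝓕 (localized f H x) ω‖) := by
        rw [← Finset.sum_mul]
        ring
    _ ≤ ((Fintype.card ι : ℝ) + 1) ^ N * (C₀ * u x + ∑ i, C i * u x) := by
        gcongr (_ + 1) ^ N * ?_
        exact add_le_add h0 (Finset.sum_le_sum fun i _ => hC i x ω)
    _ = _ := by
        rw [← Finset.sum_mul]
        ring

end Forward

section Inversion

lemma norm_iteratedFDeriv_fourier_le {g : V → ℂ}
    (hg : ∀ n : ℕ, Integrable fun v => ‖v‖ ^ n * ‖g v‖) (hgm : AEStronglyMeasurable g) (n : ℕ)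
    (y : V) : ‖iteratedFDeriv ℝ n (𝓕 g) y‖ ≤ (2 * π) ^ n * ∫ v, ‖v‖ ^ n * ‖g v‖ := by
  rw [Real.iteratedFDeriv_fourier (N := (⊤ : ℕ∞)) (fun n _ => hg n) hgm le_top, Real.fourier_eq,
    ← integral_const_mul]
  refine norm_integral_le_of_norm_le ((hg n).const_mul _) (Filter.Eventually.of_forall fun v => ?_)
  rw [Circle.norm_smul, ← mul_assoc]
  refine (VectorFourier.norm_fourierPowSMulRight_le _ _ _ _).trans ?_
  have := norm_innerSL_le (𝕜 := ℝ) (E := V)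
  have h2 : 2 * π * ‖innerSL ℝ (E := V)‖ ≤ 2 * π :=
    mul_le_of_le_one_right (by positivity) this
  gcongr

lemma integrable_one_add_norm_pow_inv :
    Integrable fun v : V => ((1 + ‖v‖) ^ (finrank ℝ V + 1))⁻¹ := by
  have := integrable_one_add_norm (E := V) (μ := volume) (r := ((finrank ℝ V + 1 : ℕ) : ℝ))
    (by push_cast; linarith)
  refine this.congr (Filter.Eventually.of_forall fun v => ?_)
  simp only
  rw [Real.rpow_neg (by positivity), Real.rpow_natCast]

lemma RapidDecay.norm_pow_mul_le {f : V → ℂ} {H : 𝓢(V, ℂ)} {u : V → ℝ} (hQ : RapidDecay f H u)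
    (n : ℕ) : ∃ C : ℝ, ∀ x ω, ‖ω‖ ^ n * ‖𝓕 (localized f H x) ω‖ ≤
      C * u x * ((1 + ‖ω‖) ^ (finrank ℝ V + 1))⁻¹ := by
  obtain ⟨C, hC⟩ := hQ (n + (finrank ℝ V + 1))
  refine ⟨C, fun x ω => ?_⟩
  rw [← div_eq_mul_inv, le_div_iff₀ (by positivity)]
  refine le_trans ?_ (hC x ω)
  rw [pow_add _ n, mul_right_comm]
  gcongr
  linarith

lemma integrable_norm_pow_mul_fourier_localized {f : V → ℂ} {H : 𝓢(V, ℂ)} {u : V → ℝ}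
    (hQ : RapidDecay f H u) {x : V} (hi : Integrable (localized f H x)) (n : ℕ) :
    Integrable fun ω => ‖ω‖ ^ n * ‖𝓕 (localized f H x) ω‖ := by
  obtain ⟨C, hC⟩ := hQ.norm_pow_mul_le n
  have hc : Continuous (𝓕 (localized f H x)) :=
    VectorFourier.fourierIntegral_continuous Real.continuous_fourierChar continuous_inner hi
  refine (integrable_one_add_norm_pow_inv.const_mul (C * u x)).mono'
    ((by fun_prop : Continuous _).aestronglyMeasurable) (Filter.Eventually.of_forall fun ω => ?_)
  rw [Real.norm_of_nonneg (by positivity)]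
  exact hC x ω

lemma exists_norm_iteratedFDeriv_localized_le {f : V → ℂ} (hf : Continuous f) {H : 𝓢(V, ℂ)}
    {u : V → ℝ} (hi : ∀ x, Integrable (localized f H x)) (hQ : RapidDecay f H u) (n : ℕ) :
    ∃ C : ℝ, ∀ x y, ‖iteratedFDeriv ℝ n (localized f H x) y‖ ≤ C * u x := by
  obtain ⟨C, hC⟩ := hQ.norm_pow_mul_le n
  refine ⟨(2 * π) ^ n * (C * ∫ v : V, ((1 + ‖v‖) ^ (finrank ℝ V + 1))⁻¹), fun x y => ?_⟩
  have hc : Continuous (𝓕 (localized f H x)) :=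
    VectorFourier.fourierIntegral_continuous Real.continuous_fourierChar continuous_inner (hi x)
  have hgi := integrable_norm_pow_mul_fourier_localized hQ (hi x)
  have h0 : Integrable (𝓕 (localized f H x)) :=
    (integrable_norm_iff hc.aestronglyMeasurable).1 (by simpa using hgi 0)
  have hinv : localized f H x = 𝓕 (fun ω => 𝓕 (localized f H x) (-ω)) := by
    rw [← Real.fourierInv_eq_fourier_comp_neg]
    exact ((hf.localized H x).fourierInv_fourier_eq (hi x) h0).symm
  have hgi' (k : ℕ) : Integrable fun ω => ‖ω‖ ^ k * ‖𝓕 (localized f H x) (-ω)‖ := by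
    simpa using (hgi k).comp_neg
  rw [hinv]
  refine (norm_iteratedFDeriv_fourier_le hgi'
    (hc.comp continuous_neg).aestronglyMeasurable n y).trans ?_
  rw [mul_assoc, mul_right_comm C, ← integral_const_mul (C * u x)]
  refine mul_le_mul_of_nonneg_left ?_ (by positivity)
  refine integral_mono (hgi' n) (integrable_one_add_norm_pow_inv.const_mul _) fun ω => ?_
  simpa using hC x (-ω)

lemma exists_norm_iteratedFDeriv_le_of_rapidDecay {f : V → ℂ} (hf : ContDiff ℝ (⊤ : ℕ∞) f)
    {H : 𝓢(V, ℂ)} {y₀ : V} (hH : H y₀ ≠ 0) {u : V → ℝ} {κ : ℕ} (hu : IsModerate u κ)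
    (hi : ∀ x, Integrable (localized f H x)) (hQ : RapidDecay f H u) (n : ℕ) :
    ∃ C : ℝ, ∀ z, ‖iteratedFDeriv ℝ n f z‖ ≤ C * u z := by
  choose C hC using exists_norm_iteratedFDeriv_localized_le hf.continuous hi hQ
  have hs : IsOpen {y | H y ≠ 0} := isOpen_ne_fun H.continuous continuous_const
  have hinv : ContDiffOn ℝ (⊤ : ℕ∞) (fun y => (H y)⁻¹) {y | H y ≠ 0} :=
    (H.smooth _).contDiffOn.inv fun _ hy => hy
  have hC0 (i : ℕ) : 0 ≤ C i :=
    nonneg_of_mul_nonneg_left ((norm_nonneg _).trans (hC i 0 0)) (hu.pos 0)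
  refine ⟨(∑ i ∈ Finset.range (n + 1), n.choose i * C i *
    ‖iteratedFDerivWithin ℝ (n - i) (fun y => (H y)⁻¹) {y | H y ≠ 0} y₀‖) * (1 + ‖-y₀‖) ^ κ,
    fun z => ?_⟩
  have key := norm_iteratedFDerivWithin_mul_le ((hf.localized H (z - y₀)).contDiffOn) hinv
    hs.uniqueDiffOn hH (n := n) (by exact_mod_cast le_top)
  have e : Set.EqOn (fun y => localized f H (z - y₀) y * (H y)⁻¹) (fun y => f (z - y₀ + y))
      {y | H y ≠ 0} := fun y hy => mul_inv_cancel_right₀ hy _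
  rw [iteratedFDerivWithin_congr e hH, iteratedFDerivWithin_of_isOpen n hs hH,
    iteratedFDeriv_comp_add_left, sub_add_cancel] at key
  refine key.trans ?_
  have hux := hu.add_le z (-y₀)
  rw [← sub_eq_add_neg] at hux
  calc _ ≤ ∑ i ∈ Finset.range (n + 1), n.choose i * (C i * (u z * (1 + ‖-y₀‖) ^ κ)) *
        ‖iteratedFDerivWithin ℝ (n - i) (fun y => (H y)⁻¹) {y | H y ≠ 0} y₀‖ := by
        gcongr with i
        rw [iteratedFDerivWithin_of_isOpen i hs hH]
        exact (hC i _ _).trans (mul_le_mul_of_nonneg_left hux (hC0 i))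
    _ = _ := by
        rw [Finset.sum_mul, Finset.sum_mul]
        exact Finset.sum_congr rfl fun i _ => by ring

end Inversion

section Bootstrap

/-- A Lipschitz function with Lipschitz constant and size controlled by `L` is bounded pointwise by
its weighted `L^r` quasi-norm, for every `r > 0`. -/
lemma rpow_mul_le_of_lintegral_le {g : V → ℝ} {L I r : ℝ} {N : ℕ} (hr : 0 < r) (hL : 0 ≤ L)
    (hI : 0 ≤ I) (hg : ∀ ω, 0 ≤ g ω) (hlip : ∀ ω ω', |g ω - g ω'| ≤ L * ‖ω - ω'‖) {ω₀ : V}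
    (hsup : g ω₀ ≤ L)
    (hint : ∫⁻ ω, ENNReal.ofReal (((1 + ‖ω‖) ^ N * g ω) ^ r) ≤ ENNReal.ofReal I) :
    g ω₀ ^ (r + finrank ℝ V) * ((1 + ‖ω₀‖) ^ N) ^ r ≤
      ((2 ^ (N + 1)) ^ r * 2 ^ finrank ℝ V / volume.real (Metric.ball (0 : V) 1)) *
        L ^ finrank ℝ V * I := by
  set D := finrank ℝ V
  have hβ : 0 < volume.real (Metric.ball (0 : V) 1) :=
    ENNReal.toReal_pos (Metric.measure_ball_pos volume _ one_pos).ne' measure_ball_lt_top.ne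
  set β := volume.real (Metric.ball (0 : V) 1)
  rcases (hg ω₀).eq_or_lt with h0 | h0
  · rw [← h0, Real.zero_rpow (by positivity), zero_mul]
    positivity
  have hL' : 0 < L := h0.trans_le hsup
  set A := g ω₀
  set ρ := A / (2 * L) with hρ
  have hρ0 : 0 < ρ := by positivity
  have hρ1 : ρ ≤ 1 / 2 := by
    rw [hρ, div_le_iff₀ (by positivity)]
    linarith
  have hball (ω : V) (hω : ω ∈ Metric.ball ω₀ ρ) :
      ((1 + ‖ω₀‖) / 2) ^ N * (A / 2) ≤ (1 + ‖ω‖) ^ N * g ω := by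
    rw [mem_ball_iff_norm'] at hω
    have h1 : A / 2 ≤ g ω := by
      have h2 : L * ‖ω₀ - ω‖ ≤ A / 2 := by
        calc L * ‖ω₀ - ω‖ ≤ L * ρ := by gcongr
          _ = A / 2 := by rw [hρ]; field_simp
      linarith [le_abs_self (A - g ω), hlip ω₀ ω]
    have h2 : (1 + ‖ω₀‖) / 2 ≤ 1 + ‖ω‖ := by
      have := norm_sub_norm_le ω₀ ω
      linarith [norm_nonneg ω]
    gcongr
  set B := ((1 + ‖ω₀‖) / 2) ^ N * (A / 2) with hB
  have hB0 : 0 ≤ B := by positivity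
  have hBr : B ^ r * (ρ ^ D * β) ≤ I := by
    rw [← ENNReal.ofReal_le_ofReal_iff hI]
    refine le_trans ?_ hint
    calc ENNReal.ofReal (B ^ r * (ρ ^ D * β))
        = ENNReal.ofReal (B ^ r) * volume (Metric.ball ω₀ ρ) := by
          rw [Measure.addHaar_ball_of_pos volume ω₀ hρ0, ENNReal.ofReal_mul (by positivity),
            ENNReal.ofReal_mul (by positivity),
            ofReal_measureReal measure_ball_lt_top.ne]
      _ = ∫⁻ _ in Metric.ball ω₀ ρ, ENNReal.ofReal (B ^ r) := by rw [setLIntegral_const]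
      _ ≤ ∫⁻ ω in Metric.ball ω₀ ρ, ENNReal.ofReal (((1 + ‖ω‖) ^ N * g ω) ^ r) := by
          refine setLIntegral_mono' measurableSet_ball fun ω hω => ?_
          exact ENNReal.ofReal_le_ofReal (Real.rpow_le_rpow hB0 (hball ω hω) hr.le)
      _ ≤ _ := setLIntegral_le_lintegral _ _
  have e1 : A ^ r * ((1 + ‖ω₀‖) ^ N) ^ r = (2 ^ (N + 1)) ^ r * B ^ r := by
    rw [← Real.mul_rpow (by positivity) (by positivity),
      ← Real.mul_rpow (by positivity) (by positivity), hB]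
    congr 1
    rw [div_pow]
    field_simp
    ring
  have e2 : A ^ D = 2 ^ D * L ^ D * ρ ^ D := by
    rw [← mul_pow, ← mul_pow, hρ]
    congr 1
    field_simp
  calc A ^ (r + D) * ((1 + ‖ω₀‖) ^ N) ^ r
      = (A ^ r * ((1 + ‖ω₀‖) ^ N) ^ r) * A ^ D := by
        rw [Real.rpow_add h0, Real.rpow_natCast]
        ring
    _ = (2 ^ (N + 1)) ^ r * 2 ^ D / β * L ^ D * (B ^ r * (ρ ^ D * β)) := by
        rw [e1, e2]
        field_simp
    _ ≤ _ := by gcongr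

/-- The weighted mixed `L^∞`-`L^r` bound on the short-time Fourier transform. -/
def LpDecay (r : ℝ) (f : V → ℂ) (H : 𝓢(V, ℂ)) (u : V → ℝ) : Prop :=
  ∀ N : ℕ, ∃ M : ℝ, 0 ≤ M ∧ ∀ x,
    ∫⁻ ω, ENNReal.ofReal (((1 + ‖ω‖) ^ N * ‖𝓕 (localized f H x) ω‖) ^ r) ≤
      ENNReal.ofReal (M * u x ^ r)

lemma LpDecay.exists_fourier_localized_le {r : ℝ} (hr : 0 < r) {f : V → ℂ} (hf : Continuous f)
    {H : 𝓢(V, ℂ)} {u₀ : V → ℝ} (hu₀ : ∀ x, 0 ≤ u₀ x) (hlp : LpDecay r f H u₀) (κ N : ℕ) :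
    ∃ c : ℝ, 0 ≤ c ∧ ∀ (u : V → ℝ) (S : ℝ), IsModerate u κ → (∀ x, u₀ x ≤ u x) → 0 ≤ S →
      (∀ z, ‖f z‖ ≤ S * u z) → ∀ x ω, (1 + ‖ω‖) ^ N * ‖𝓕 (localized f H x) ω‖ ≤
        c * S ^ ((finrank ℝ V : ℝ) / (r + finrank ℝ V)) * u x := by
  set D := finrank ℝ V
  obtain ⟨M, hM0, hM⟩ := hlp ⌈N * (r + D) / r⌉₊
  set N' := ⌈N * (r + D) / r⌉₊
  have hN' : N * (r + D) ≤ N' * r := (div_le_iff₀ hr).1 (Nat.le_ceil _)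
  set K := 2 * π * (∫ y, (1 + ‖y‖) ^ (κ + 1) * ‖H y‖) + ∫ y, (1 + ‖y‖) ^ κ * ‖H y‖ with hK
  have hK1 : 0 ≤ ∫ y, (1 + ‖y‖) ^ (κ + 1) * ‖H y‖ := integral_nonneg fun y => by positivity
  have hK2 : 0 ≤ ∫ y, (1 + ‖y‖) ^ κ * ‖H y‖ := integral_nonneg fun y => by positivity
  have hK0 : 0 ≤ K := by positivity
  set c₀ := ((2 ^ (N' + 1)) ^ r * 2 ^ D / volume.real (Metric.ball (0 : V) 1)) * K ^ D * M
  have hc₀ : 0 ≤ c₀ := by positivity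
  have hrD : 0 < r + D := by positivity
  refine ⟨c₀ ^ (1 / (r + D)), by positivity, fun u S hu hu₀u hS hfS x ω => ?_⟩
  have hux := hu.pos x
  have key := rpow_mul_le_of_lintegral_le (g := fun ω => ‖𝓕 (localized f H x) ω‖)
    (L := K * (S * u x)) (ω₀ := ω) hr (by positivity)
    (mul_nonneg hM0 (Real.rpow_nonneg (hu₀ x) r)) (fun _ => norm_nonneg _)
    (fun ω ω' => by
      refine (abs_norm_sub_norm_le _ _).trans
        ((norm_fourier_localized_sub_le hf hu hS hfS H x ω ω').trans ?_)
      refine mul_le_mul_of_nonneg_right ?_ (norm_nonneg _)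
      have : 0 ≤ (∫ y, (1 + ‖y‖) ^ κ * ‖H y‖) * (S * u x) := by positivity
      linear_combination this)
    (by
      refine (norm_fourier_localized_le hu hS hfS H x ω).trans ?_
      rw [hK, add_mul, mul_comm]
      have : 0 ≤ 2 * π * (∫ y, (1 + ‖y‖) ^ (κ + 1) * ‖H y‖) * (S * u x) := by positivity
      linarith)
    (hM x)
  set A := ‖𝓕 (localized f H x) ω‖
  have hA : 0 ≤ A := norm_nonneg _
  have hω : 1 ≤ 1 + ‖ω‖ := by linarith [norm_nonneg ω]
  have h1 : ((1 + ‖ω‖) ^ N * A) ^ (r + D) ≤ c₀ * S ^ D * u x ^ (r + D) := by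
    calc ((1 + ‖ω‖) ^ N * A) ^ (r + D)
        = A ^ (r + D) * (1 + ‖ω‖) ^ (N * (r + D)) := by
          rw [Real.mul_rpow (by positivity) hA, ← Real.rpow_natCast, ← Real.rpow_mul (by positivity)]
          ring
      _ ≤ A ^ (r + D) * (1 + ‖ω‖) ^ (N' * r) := by gcongr
      _ = A ^ (r + D) * ((1 + ‖ω‖) ^ N') ^ r := by
          rw [← Real.rpow_natCast (1 + ‖ω‖) N', ← Real.rpow_mul (by positivity)]
      _ ≤ _ := key
      _ ≤ ((2 ^ (N' + 1)) ^ r * 2 ^ D / volume.real (Metric.ball (0 : V) 1)) *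
          (K * (S * u x)) ^ D * (M * u x ^ r) := by
          gcongr
          · exact hu₀ x
          · exact hu₀u x
      _ = _ := by
          rw [Real.rpow_add hux, Real.rpow_natCast, mul_pow, mul_pow]
          ring
  calc (1 + ‖ω‖) ^ N * A = (((1 + ‖ω‖) ^ N * A) ^ (r + D)) ^ (1 / (r + D)) := by
        rw [← Real.rpow_mul (by positivity), mul_one_div_cancel hrD.ne', Real.rpow_one]
    _ ≤ (c₀ * S ^ D * u x ^ (r + D)) ^ (1 / (r + D)) := by gcongr
    _ = _ := by
        rw [Real.mul_rpow (by positivity) (by positivity), Real.mul_rpow hc₀ (by positivity),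
          ← Real.rpow_mul hux.le, mul_one_div_cancel hrD.ne', Real.rpow_one, ← Real.rpow_natCast S,
          ← Real.rpow_mul hS, mul_one_div]

lemma norm_localized_le_of_fourier_le {f : V → ℂ} (hf : Continuous f) {H : 𝓢(V, ℂ)} {x : V}
    (hi : Integrable (localized f H x)) {B : ℝ}
    (hB : ∀ ω, (1 + ‖ω‖) ^ (finrank ℝ V + 1) * ‖𝓕 (localized f H x) ω‖ ≤ B) (y : V) :
    ‖localized f H x y‖ ≤ B * ∫ ω : V, ((1 + ‖ω‖) ^ (finrank ℝ V + 1))⁻¹ := by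
  have hB' (ω : V) : ‖𝓕 (localized f H x) ω‖ ≤ B * ((1 + ‖ω‖) ^ (finrank ℝ V + 1))⁻¹ := by
    rw [← div_eq_mul_inv, le_div_iff₀' (by positivity)]
    exact hB ω
  have hc : Continuous (𝓕 (localized f H x)) :=
    VectorFourier.fourierIntegral_continuous Real.continuous_fourierChar continuous_inner hi
  have hint : Integrable (𝓕 (localized f H x)) :=
    (integrable_one_add_norm_pow_inv.const_mul B).mono' hc.aestronglyMeasurable
      (Filter.Eventually.of_forall hB')
  rw [← congrFun ((hf.localized H x).fourierInv_fourier_eq hi hint) y, Real.fourierInv_eq,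
    ← integral_const_mul]
  refine norm_integral_le_of_norm_le (integrable_one_add_norm_pow_inv.const_mul B)
    (Filter.Eventually.of_forall fun ω => ?_)
  rw [Circle.norm_smul]
  exact hB' ω

lemma le_rpow_of_le_mul_rpow {S c θ : ℝ} (hS : 0 ≤ S) (hc : 0 ≤ c) (hθ : θ < 1)
    (h : S ≤ c * S ^ θ) : S ≤ c ^ (1 / (1 - θ)) := by
  rcases hS.eq_or_lt with rfl | hS
  · positivity
  have hθ' : 0 < 1 - θ := by linarith
  have h1 : S ^ (1 - θ) ≤ c := by
    rw [Real.rpow_sub hS, Real.rpow_one, div_le_iff₀ (by positivity)]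
    exact h
  calc S = (S ^ (1 - θ)) ^ (1 / (1 - θ)) := by
        rw [← Real.rpow_mul hS.le, mul_one_div_cancel hθ'.ne', Real.rpow_one]
    _ ≤ _ := by gcongr

/-- Uniform a priori estimate: a function that is bounded by some multiple of the weight `u` is
bounded by a multiple of `u` depending only on the decay of its short-time Fourier transform. -/
lemma LpDecay.exists_uniform_bound {r : ℝ} (hr : 0 < r) {f : V → ℂ} (hf : Continuous f)
    {H : 𝓢(V, ℂ)} {y₀ : V} (hH : H y₀ ≠ 0) {u₀ : V → ℝ} (hu₀ : ∀ x, 0 ≤ u₀ x)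
    (hlp : LpDecay r f H u₀) (κ : ℕ) :
    ∃ C : ℝ, ∀ u : V → ℝ, IsModerate u κ → (∀ x, u₀ x ≤ u x) →
      (∃ S : ℝ, ∀ z, ‖f z‖ ≤ S * u z) → ∀ z, ‖f z‖ ≤ C * u z := by
  obtain ⟨c, hc, hcb⟩ := hlp.exists_fourier_localized_le hr hf hu₀ κ (finrank ℝ V + 1)
  set θ := (finrank ℝ V : ℝ) / (r + finrank ℝ V) with hθ
  have hθ1 : θ < 1 := by
    rw [hθ, div_lt_one (by positivity)]
    linarith
  set J := ∫ ω : V, ((1 + ‖ω‖) ^ (finrank ℝ V + 1))⁻¹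
  have hJ : 0 ≤ J := integral_nonneg fun ω => by positivity
  have hH' : 0 < ‖H y₀‖ := norm_pos_iff.2 hH
  set c₁ := c * J * (1 + ‖-y₀‖) ^ κ / ‖H y₀‖ with hc₁
  have hc₁0 : 0 ≤ c₁ := by positivity
  refine ⟨c₁ ^ (1 / (1 - θ)), fun u hu hu₀u ⟨S₀, hS₀⟩ z => ?_⟩
  set S := ⨆ z, ‖f z‖ / u z
  have hbdd : BddAbove (Set.range fun z => ‖f z‖ / u z) := by
    refine ⟨S₀, ?_⟩
    rintro _ ⟨z, rfl⟩
    exact (div_le_iff₀ (hu.pos z)).2 (hS₀ z)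
  have hSle (z : V) : ‖f z‖ / u z ≤ S := le_ciSup hbdd z
  have hS0 : 0 ≤ S := (div_nonneg (norm_nonneg _) (hu.pos 0).le).trans (hSle 0)
  have hfS (z : V) : ‖f z‖ ≤ S * u z := (div_le_iff₀ (hu.pos z)).1 (hSle z)
  have himp (z : V) : ‖f z‖ / u z ≤ c₁ * S ^ θ := by
    have h1 := norm_localized_le_of_fourier_le hf
      (integrable_localized hf hu hS0 hfS H (z - y₀)) (hcb u S hu hu₀u hS0 hfS (z - y₀)) y₀
    rw [localized, sub_add_cancel, norm_mul] at h1
    have h2 := hu.add_le z (-y₀)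
    rw [← sub_eq_add_neg] at h2
    rw [div_le_iff₀ (hu.pos z), hc₁]
    have h3 : ‖f z‖ * ‖H y₀‖ ≤ c * S ^ θ * (u z * (1 + ‖-y₀‖) ^ κ) * J := by
      refine h1.trans ?_
      gcongr
    rw [← le_div_iff₀ hH'] at h3
    refine h3.trans (le_of_eq ?_)
    ring
  have hSb : S ≤ c₁ ^ (1 / (1 - θ)) := le_rpow_of_le_mul_rpow hS0 hc₁0 hθ1 (ciSup_le himp)
  exact (hfS z).trans (mul_le_mul_of_nonneg_right hSb (hu.pos z).le)

lemma LpDecay.exists_norm_le {r : ℝ} (hr : 0 < r) {f : V → ℂ} (hf : Continuous f)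
    {H : 𝓢(V, ℂ)} (hH : H ≠ 0) {m : ℝ} (hlp : LpDecay r f H fun x => japBracket x ^ m)
    {C₀ k : ℝ} (hk : ∀ z, ‖f z‖ ≤ C₀ * japBracket z ^ k) :
    ∃ C : ℝ, ∀ z, ‖f z‖ ≤ C * japBracket z ^ m := by
  obtain ⟨y₀, hy₀⟩ : ∃ y₀, H y₀ ≠ 0 := by
    by_contra! h
    exact hH (SchwartzMap.ext h)
  have hm := isModerate_japBracket_rpow (V := V) m
  set K := ⌈k - m⌉₊
  have hK : k ≤ m + K := by linarith [Nat.le_ceil (k - m)]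
  obtain ⟨C, hC⟩ := hlp.exists_uniform_bound hr hf hy₀ (fun x => (hm.pos x).le) (⌈|m|⌉₊ + K)
  have hC₀ : 0 ≤ C₀ := nonneg_of_mul_nonneg_left ((norm_nonneg _).trans (hk 0))
    (Real.rpow_pos_of_pos (japBracket_pos 0) k)
  refine ⟨C, fun z => ?_⟩
  have hε (ε : ℝ) (h : 0 < ε) :
      ‖f z‖ ≤ C * (japBracket z ^ m * (1 + ε * japBracket z) ^ K) := by
    refine hC _ (hm.mul_one_add_pow K h.le) (fun x => ?_) ⟨C₀ * (ε ^ K)⁻¹, fun x => ?_⟩ z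
    · have := japBracket_pos x
      exact le_mul_of_one_le_right (hm.pos x).le
        (one_le_pow₀ (le_add_of_nonneg_right (by positivity)))
    · have hx := japBracket_pos x
      calc ‖f x‖ ≤ C₀ * japBracket x ^ k := hk x
        _ ≤ C₀ * japBracket x ^ (m + K) := by
            gcongr
            exact one_le_japBracket x
        _ = C₀ * (ε ^ K)⁻¹ * (japBracket x ^ m * (ε * japBracket x) ^ K) := by
            rw [Real.rpow_add hx, Real.rpow_natCast, mul_pow]
            field_simp
        _ ≤ _ := by
            gcongr
            linarith
  have ht : Filter.Tendsto (fun ε : ℝ => C * (japBracket z ^ m * (1 + ε * japBracket z) ^ K))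
      (nhdsWithin 0 (Set.Ioi 0)) (nhds (C * japBracket z ^ m)) := by
    refine Filter.Tendsto.mono_left ?_ nhdsWithin_le_nhds
    have : Continuous fun ε : ℝ => C * (japBracket z ^ m * (1 + ε * japBracket z) ^ K) := by
      fun_prop
    simpa using this.tendsto 0
  exact ge_of_tendsto ht (Filter.eventually_of_mem self_mem_nhdsWithin hε)

lemma LpDecay.rapidDecay {r : ℝ} (hr : 0 < r) {f : V → ℂ} (hf : Continuous f) {H : 𝓢(V, ℂ)}
    {u : V → ℝ} {κ : ℕ} (hu : IsModerate u κ) (hlp : LpDecay r f H u) {S : ℝ}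
    (hS : ∀ z, ‖f z‖ ≤ S * u z) : RapidDecay f H u := by
  intro N
  obtain ⟨c, -, hc⟩ := hlp.exists_fourier_localized_le hr hf (fun x => (hu.pos x).le) κ N
  have hS0 : 0 ≤ S := nonneg_of_mul_nonneg_left ((norm_nonneg _).trans (hS 0)) (hu.pos 0)
  exact ⟨_, hc u S hu (fun _ => le_rfl) hS0 hS⟩

end Bootstrap

end LocalFourier

section DirectionalDerivatives

variable {E F : Type*} [NormedAddCommGroup E] [NormedSpace ℝ E] [NormedAddCommGroup F]
  [NormedSpace ℝ F]

lemma pdir_comp_equiv (e : E ≃L[ℝ] F) (h : F → ℂ) (v : E) : pdir v (h ∘ e) = pdir (e v) h ∘ e := by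
  ext y
  simp only [pdir, e.comp_right_fderiv, Function.comp_apply]
  rfl

lemma mpdList_comp_equiv (e : E ≃L[ℝ] F) (h : F → ℂ) (vs : List E) :
    mpdList vs (h ∘ e) = mpdList (vs.map e) h ∘ e := by
  induction vs with
  | nil => rfl
  | cons v vs ih =>
    have : mpdList (v :: vs) (h ∘ e) = pdir v (mpdList vs (h ∘ e)) := rfl
    rw [this, ih, pdir_comp_equiv]
    rfl

lemma mpdList_replicate (v : E) (h : E → ℂ) (k : ℕ) :
    mpdList (List.replicate k v) h = (pdir v)^[k] h := by
  induction k with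
  | zero => rfl
  | succ k ih =>
    rw [Function.iterate_succ_apply', ← ih]
    rfl

lemma mpdList_eq_iteratedFDeriv {h : E → ℂ} (hh : ContDiff ℝ (⊤ : ℕ∞) h) (vs : List E) :
    mpdList vs h = fun z => iteratedFDeriv ℝ vs.length h z vs.get := by
  induction vs with
  | nil =>
    ext z
    exact (iteratedFDeriv_zero_apply _).symm
  | cons v vs ih =>
    ext z
    have : mpdList (v :: vs) h z = fderiv ℝ (mpdList vs h) z v := rfl
    have hd : DifferentiableAt ℝ (iteratedFDeriv ℝ vs.length h) z :=
      (hh.differentiable_iteratedFDeriv (by exact_mod_cast ENat.natCast_lt_top _)) z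
    rw [this, ih]
    change _ = iteratedFDeriv ℝ (vs.length + 1) h z (v :: vs).get
    rw [iteratedFDeriv_succ_apply_left, fderiv_continuousMultilinear_apply_const_apply hd]
    rfl

lemma norm_mpdList_le {h : E → ℂ} (hh : ContDiff ℝ (⊤ : ℕ∞) h) (vs : List E) (z : E) :
    ‖mpdList vs h z‖ ≤ ‖iteratedFDeriv ℝ vs.length h z‖ * ∏ i, ‖vs.get i‖ := by
  rw [mpdList_eq_iteratedFDeriv hh]
  exact ContinuousMultilinearMap.le_opNorm _ _

end DirectionalDerivatives

section PhaseSpace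

/-- Euclidean model of the phase space `ℝ^d × ℝ^d`. -/
abbrev PhaseSpace (d : ℕ) := EuclideanSpace ℝ (Fin d ⊕ Fin d)

/-- Identification of the Euclidean model of phase space with `ℝ^d × ℝ^d`. -/
def phaseEquiv (d : ℕ) : PhaseSpace d ≃L[ℝ] (Fin d → ℝ) × (Fin d → ℝ) :=
  (EuclideanSpace.equiv (Fin d ⊕ Fin d) ℝ).trans
    (ContinuousLinearEquiv.sumPiEquivProdPi ℝ (Fin d) (Fin d) fun _ => ℝ)

@[simp] lemma phaseEquiv_fst (z : PhaseSpace d) (i : Fin d) :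
    (phaseEquiv d z).1 i = z (Sum.inl i) := rfl

@[simp] lemma phaseEquiv_snd (z : PhaseSpace d) (i : Fin d) :
    (phaseEquiv d z).2 i = z (Sum.inr i) := rfl

lemma measurePreserving_phaseEquiv : MeasurePreserving (phaseEquiv d) :=
  (measurePreserving_sumPiEquivProdPi fun _ : Fin d ⊕ Fin d => (volume : Measure ℝ)).comp
    (PiLp.volume_preserving_ofLp (Fin d ⊕ Fin d))

lemma jb2_phaseEquiv (z : PhaseSpace d) : jb2 (phaseEquiv d z) = japBracket z := by
  rw [jb2, japBracket, EuclideanSpace.norm_sq_eq, Fintype.sum_sum_type, add_assoc]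
  simp

lemma phaseEquiv_single_inl (i : Fin d) :
    phaseEquiv d (EuclideanSpace.single (Sum.inl i) 1) = (Pi.single i 1, 0) := by
  ext j <;> simp [Pi.single_apply]

lemma phaseEquiv_single_inr (i : Fin d) :
    phaseEquiv d (EuclideanSpace.single (Sum.inr i) 1) = (0, Pi.single i 1) := by
  ext j <;> simp [Pi.single_apply]

lemma flatMap_replicate_single {ι α : Type*} [DecidableEq ι] (g : ι → α) (i : ι) (k : ℕ)
    (l : List ι) (hl : l.Nodup) (hi : i ∈ l) :
    (l.flatMap fun j => List.replicate ((Pi.single i k : ι → ℕ) j) (g j)) =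
      List.replicate k (g i) := by
  have h0 (l : List ι) (hi : i ∉ l) :
      (l.flatMap fun j => List.replicate ((Pi.single i k : ι → ℕ) j) (g j)) = [] := by
    rw [List.flatMap_eq_nil_iff]
    intro j hj
    rw [Pi.single_eq_of_ne (ne_of_mem_of_not_mem hj hi), List.replicate_zero]
  induction l with
  | nil => simp at hi
  | cons j l ih =>
    rw [List.nodup_cons] at hl
    rw [List.flatMap_cons]
    rcases List.mem_cons.1 hi with rfl | hi'
    · rw [h0 l hl.1, Pi.single_eq_same, List.append_nil]
    · rw [ih hl.2 hi', Pi.single_eq_of_ne (ne_of_mem_of_not_mem hi' hl.1).symm,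
        List.replicate_zero, List.nil_append]

lemma stdList_single (i : Fin d) (k : ℕ) :
    stdList d (Pi.single i k) = List.replicate k (Pi.single i 1) :=
  flatMap_replicate_single _ i k _ (List.nodup_finRange d) (List.mem_finRange i)

lemma stdList_zero : stdList d 0 = [] := by
  simp [stdList]

lemma iterate_pdir_single_inl (σ : (Fin d → ℝ) × (Fin d → ℝ) → ℂ) (i : Fin d) (k : ℕ) :
    (pdir (EuclideanSpace.single (Sum.inl i) 1))^[k] (σ ∘ phaseEquiv d) =
      mpd2 (Pi.single i k, 0) σ ∘ phaseEquiv d := by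
  rw [← mpdList_replicate, mpdList_comp_equiv, List.map_replicate, phaseEquiv_single_inl, mpd2,
    stdList2, stdList_single, stdList_zero, List.map_replicate, List.map_nil, List.append_nil]

lemma iterate_pdir_single_inr (σ : (Fin d → ℝ) × (Fin d → ℝ) → ℂ) (i : Fin d) (k : ℕ) :
    (pdir (EuclideanSpace.single (Sum.inr i) 1))^[k] (σ ∘ phaseEquiv d) =
      mpd2 (0, Pi.single i k) σ ∘ phaseEquiv d := by
  rw [← mpdList_replicate, mpdList_comp_equiv, List.map_replicate, phaseEquiv_single_inr, mpd2,
    stdList2, stdList_single, stdList_zero, List.map_replicate, List.map_nil, List.nil_append]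

/-- The conjugate window, in Euclidean coordinates. -/
def phaseWindow (G : 𝓢((Fin d → ℝ) × (Fin d → ℝ), ℂ)) : 𝓢(PhaseSpace d, ℂ) :=
  SchwartzMap.postcompCLM (𝕜 := ℝ) Complex.conjCLE.toContinuousLinearMap
    (SchwartzMap.compCLMOfContinuousLinearEquiv ℝ (phaseEquiv d) G)

lemma phaseWindow_apply (G : 𝓢((Fin d → ℝ) × (Fin d → ℝ), ℂ)) (y : PhaseSpace d) :
    phaseWindow G y = (starRingEnd ℂ) (G (phaseEquiv d y)) := rfl

lemma phaseWindow_ne_zero {G : 𝓢((Fin d → ℝ) × (Fin d → ℝ), ℂ)} (hG : G ≠ 0) :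
    phaseWindow G ≠ 0 := by
  contrapose! hG
  ext z
  have := congrArg (fun H : 𝓢(PhaseSpace d, ℂ) => H ((phaseEquiv d).symm z)) hG
  simpa [phaseWindow_apply] using this

lemma sum_mul_phaseEquiv (ω p : PhaseSpace d) :
    ∑ i, (phaseEquiv d ω).1 i * (phaseEquiv d p).1 i +
      ∑ i, (phaseEquiv d ω).2 i * (phaseEquiv d p).2 i = ⟪p, ω⟫_ℝ := by
  simp [PiLp.inner_apply, Fintype.sum_sum_type]

lemma norm_stft2_phaseEquiv (G : 𝓢((Fin d → ℝ) × (Fin d → ℝ), ℂ))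
    (σ : (Fin d → ℝ) × (Fin d → ℝ) → ℂ) (x ω : PhaseSpace d) :
    ‖stft2 G σ (phaseEquiv d x) (phaseEquiv d ω)‖ =
      ‖𝓕 (localized (σ ∘ phaseEquiv d) (phaseWindow G) x) ω‖ := by
  have hemb : MeasurableEmbedding (phaseEquiv d) :=
    (phaseEquiv d).toHomeomorph.measurableEmbedding
  have h : stft2 G σ (phaseEquiv d x) (phaseEquiv d ω) =
      (𝐞 (-⟪x, ω⟫_ℝ) : ℂ) * 𝓕 (localized (σ ∘ phaseEquiv d) (phaseWindow G) x) ω := by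
    rw [stft2, ← measurePreserving_phaseEquiv.integral_comp hemb,
      ← integral_add_left_eq_self _ x, Real.fourier_eq, ← integral_const_mul]
    refine integral_congr_ae (Filter.Eventually.of_forall fun y => ?_)
    have hs := congrArg (fun t : ℝ => (t : ℂ)) (sum_mul_phaseEquiv ω (x + y))
    rw [Complex.ofReal_add] at hs
    simp only [localized, phaseWindow_apply, Function.comp_apply, Circle.smul_def, smul_eq_mul,
      Real.fourierChar_apply]
    rw [hs, ← map_sub, add_sub_cancel_left, ← mul_assoc, ← mul_assoc,
      ← Complex.exp_add, inner_add_left]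
    congr 3
    push_cast
    ring
  rw [h, norm_mul, Circle.norm_coe, one_mul]

lemma stft2_term_eq (m : ℝ) (G : 𝓢((Fin d → ℝ) × (Fin d → ℝ), ℂ))
    (σ : (Fin d → ℝ) × (Fin d → ℝ) → ℂ) (x ω : PhaseSpace d) :
    (‖stft2 G σ (phaseEquiv d x) (phaseEquiv d ω)‖₊ : ℝ≥0∞) *
        ENNReal.ofReal (jb2 (phaseEquiv d x) ^ (-m)) =
      ENNReal.ofReal (‖𝓕 (localized (σ ∘ phaseEquiv d) (phaseWindow G) x) ω‖ *
        japBracket x ^ (-m)) := by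
  rw [ENNReal.ofReal_mul (norm_nonneg _), ← norm_stft2_phaseEquiv, ofReal_norm, jb2_phaseEquiv]
  rfl

lemma one_add_norm_pow_le_japBracket_rpow {V : Type*} [NormedAddCommGroup V] (N : ℕ) (ω : V) :
    (1 + ‖ω‖) ^ N ≤ 2 ^ N * japBracket ω ^ (N : ℝ) := by
  rw [Real.rpow_natCast, ← mul_pow]
  gcongr
  linarith [one_le_japBracket ω, norm_le_japBracket ω]

lemma rapidDecay_of_modNorm_top_lt_top {m : ℝ} {G : 𝓢((Fin d → ℝ) × (Fin d → ℝ), ℂ)}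
    {σ : (Fin d → ℝ) × (Fin d → ℝ) → ℂ} (h : ∀ s : ℝ, 0 ≤ s → modNorm ∞ m s G σ < ⊤) :
    RapidDecay (σ ∘ phaseEquiv d) (phaseWindow G) fun x => japBracket x ^ m := by
  intro N
  have hN := h N N.cast_nonneg
  refine ⟨2 ^ N * (modNorm ∞ m N G σ).toReal, fun x ω => ?_⟩
  have hx := japBracket_pos x
  have hω := japBracket_pos ω
  set A := ‖𝓕 (localized (σ ∘ phaseEquiv d) (phaseWindow G) x) ω‖ with hA
  have hA0 : 0 ≤ A := norm_nonneg _
  have h1 : ENNReal.ofReal (A * japBracket x ^ (-m)) *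
      ENNReal.ofReal (japBracket ω ^ (N : ℝ)) ≤ modNorm ∞ m N G σ := by
    rw [hA, ← stft2_term_eq, ← jb2_phaseEquiv ω, modNorm, if_pos rfl]
    exact le_iSup₂_of_le (phaseEquiv d ω) (phaseEquiv d x) le_rfl
  rw [← ENNReal.ofReal_mul (by positivity), ENNReal.ofReal_le_iff_le_toReal hN.ne,
    Real.rpow_neg hx.le, mul_right_comm, ← div_eq_mul_inv, div_le_iff₀ (by positivity)] at h1
  calc (1 + ‖ω‖) ^ N * A ≤ 2 ^ N * japBracket ω ^ (N : ℝ) * A := by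
        gcongr
        exact one_add_norm_pow_le_japBracket_rpow N ω
    _ = 2 ^ N * (A * japBracket ω ^ (N : ℝ)) := by ring
    _ ≤ 2 ^ N * ((modNorm ∞ m N G σ).toReal * japBracket x ^ m) := by gcongr
    _ = _ := by ring

lemma lpDecay_of_modNorm_lt_top {q : ℝ≥0∞} (hq : q ≠ 0) (hq' : q ≠ ∞) {m : ℝ}
    {G : 𝓢((Fin d → ℝ) × (Fin d → ℝ), ℂ)} {σ : (Fin d → ℝ) × (Fin d → ℝ) → ℂ}
    (h : ∀ s : ℝ, 0 ≤ s → modNorm q m s G σ < ⊤) :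
    LpDecay q.toReal (σ ∘ phaseEquiv d) (phaseWindow G) fun x => japBracket x ^ m := by
  intro N
  have hr : 0 < q.toReal := ENNReal.toReal_pos hq hq'
  set r := q.toReal
  have hN := h N N.cast_nonneg
  rw [modNorm, if_neg hq', ENNReal.rpow_lt_top_iff_of_pos (by positivity),
    ← measurePreserving_phaseEquiv.lintegral_comp_emb
      (phaseEquiv d).toHomeomorph.measurableEmbedding] at hN
  set I := ∫⁻ ω : PhaseSpace d, (⨆ x, (‖stft2 G σ x (phaseEquiv d ω)‖₊ : ℝ≥0∞) *
    ENNReal.ofReal (jb2 x ^ (-m))) ^ r * ENNReal.ofReal (jb2 (phaseEquiv d ω) ^ (N : ℝ)) ^ r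
  refine ⟨(2 ^ N) ^ r * I.toReal, by positivity, fun x => ?_⟩
  have hx := japBracket_pos x
  have hfin : ENNReal.ofReal (2 ^ N * japBracket x ^ m) ^ r ≠ ∞ :=
    ENNReal.rpow_ne_top_of_nonneg hr.le ENNReal.ofReal_ne_top
  calc _ ≤ ∫⁻ ω : PhaseSpace d, ENNReal.ofReal (2 ^ N * japBracket x ^ m) ^ r *
        ((⨆ x, (‖stft2 G σ x (phaseEquiv d ω)‖₊ : ℝ≥0∞) *
          ENNReal.ofReal (jb2 x ^ (-m))) ^ r *
            ENNReal.ofReal (jb2 (phaseEquiv d ω) ^ (N : ℝ)) ^ r) := by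
        refine lintegral_mono fun ω => ?_
        have hω := japBracket_pos ω
        set A := ‖𝓕 (localized (σ ∘ phaseEquiv d) (phaseWindow G) x) ω‖ with hA
        have hA0 : 0 ≤ A := norm_nonneg _
        have h1 : ENNReal.ofReal (A * japBracket x ^ (-m)) ≤
            ⨆ x, (‖stft2 G σ x (phaseEquiv d ω)‖₊ : ℝ≥0∞) * ENNReal.ofReal (jb2 x ^ (-m)) := by
          rw [hA, ← stft2_term_eq]
          exact le_iSup_of_le (phaseEquiv d x) le_rfl
        rw [← ENNReal.ofReal_rpow_of_nonneg (by positivity) hr.le,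
          ← ENNReal.mul_rpow_of_nonneg _ _ hr.le, ← ENNReal.mul_rpow_of_nonneg _ _ hr.le]
        refine ENNReal.rpow_le_rpow ?_ hr.le
        refine le_trans ?_ (mul_le_mul_right (mul_le_mul_left h1 _) _)
        rw [jb2_phaseEquiv, ← ENNReal.ofReal_mul (by positivity),
          ← ENNReal.ofReal_mul (by positivity)]
        refine ENNReal.ofReal_le_ofReal ?_
        calc (1 + ‖ω‖) ^ N * A ≤ 2 ^ N * japBracket ω ^ (N : ℝ) * A := by
              gcongr
              exact one_add_norm_pow_le_japBracket_rpow N ω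
          _ = _ := by
              rw [Real.rpow_neg hx.le]
              field_simp
    _ = ENNReal.ofReal (2 ^ N * japBracket x ^ m) ^ r * I := lintegral_const_mul' _ _ hfin
    _ = _ := by
        rw [ENNReal.ofReal_rpow_of_nonneg (by positivity) hr.le,
          Real.mul_rpow (by positivity) (by positivity), mul_right_comm ((2 ^ N : ℝ) ^ r),
          ENNReal.ofReal_mul (by positivity) (q := I.toReal), ENNReal.ofReal_toReal hN.ne]

lemma RapidDecay.exists_mul_japBracket_rpow_le {V : Type*} [NormedAddCommGroup V]
    [InnerProductSpace ℝ V] [FiniteDimensional ℝ V] [MeasurableSpace V] [BorelSpace V] {f : V → ℂ}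
    {H : 𝓢(V, ℂ)} {m : ℝ} (hQ : RapidDecay f H fun x => japBracket x ^ m) {s : ℝ} (hs : 0 ≤ s)
    (t : ℝ) : ∃ C : ℝ, 0 ≤ C ∧ ∀ x ω, ‖𝓕 (localized f H x) ω‖ * japBracket x ^ (-m) *
      japBracket ω ^ s ≤ C * (1 + ‖ω‖) ^ (-t) := by
  obtain ⟨C, hC⟩ := hQ ⌈s + t⌉₊
  refine ⟨C, nonneg_of_mul_nonneg_left (le_trans (by positivity) (hC 0 0))
    (Real.rpow_pos_of_pos (japBracket_pos 0) m), fun x ω => ?_⟩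
  have hx := japBracket_pos x
  have hω := japBracket_pos ω
  have hω1 : 1 ≤ 1 + ‖ω‖ := by linarith [norm_nonneg ω]
  rw [Real.rpow_neg hx.le, mul_right_comm, ← div_eq_mul_inv, div_le_iff₀ (by positivity),
    Real.rpow_neg (by positivity), mul_right_comm, ← div_eq_mul_inv, le_div_iff₀ (by positivity)]
  refine le_trans ?_ (hC x ω)
  calc _ ≤ ‖𝓕 (localized f H x) ω‖ * (1 + ‖ω‖) ^ s * (1 + ‖ω‖) ^ t := by
        gcongr
        exact japBracket_le_one_add_norm ω
    _ = (1 + ‖ω‖) ^ (s + t) * ‖𝓕 (localized f H x) ω‖ := by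
        rw [Real.rpow_add (by positivity)]
        ring
    _ ≤ _ := by
        rw [← Real.rpow_natCast]
        gcongr
        exact Nat.le_ceil _

lemma modNorm_lt_top_of_rapidDecay {q : ℝ≥0∞} (hq : q ≠ 0) {m : ℝ}
    {G : 𝓢((Fin d → ℝ) × (Fin d → ℝ), ℂ)} {σ : (Fin d → ℝ) × (Fin d → ℝ) → ℂ}
    (hQ : RapidDecay (σ ∘ phaseEquiv d) (phaseWindow G) fun x => japBracket x ^ m) {s : ℝ}
    (hs : 0 ≤ s) : modNorm q m s G σ < ⊤ := by
  rw [modNorm]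
  split_ifs with hq'
  · obtain ⟨C, -, hC⟩ := hQ.exists_mul_japBracket_rpow_le hs 0
    refine lt_of_le_of_lt (iSup₂_le fun ω x => ?_) (ENNReal.ofReal_lt_top (r := C))
    obtain ⟨ω, rfl⟩ := (phaseEquiv d).surjective ω
    obtain ⟨x, rfl⟩ := (phaseEquiv d).surjective x
    have hx := japBracket_pos x
    rw [stft2_term_eq, jb2_phaseEquiv, ← ENNReal.ofReal_mul (by positivity)]
    exact ENNReal.ofReal_le_ofReal (by simpa using hC x ω)
  have hr : 0 < q.toReal := ENNReal.toReal_pos hq hq'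
  set r := q.toReal
  obtain ⟨C, hC0, hC⟩ := hQ.exists_mul_japBracket_rpow_le hs
    (((finrank ℝ (PhaseSpace d) : ℝ) + 1) / r)
  rw [ENNReal.rpow_lt_top_iff_of_pos (by positivity),
    ← measurePreserving_phaseEquiv.lintegral_comp_emb
      (phaseEquiv d).toHomeomorph.measurableEmbedding]
  have hint := (integrable_one_add_norm (E := PhaseSpace d) (μ := volume)
    (lt_add_one (finrank ℝ (PhaseSpace d) : ℝ))).const_mul (C ^ r)
  refine lt_of_le_of_lt (lintegral_mono fun ω => ?_) hint.lintegral_lt_top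
  have hω := japBracket_pos ω
  have hω0 : 0 < 1 + ‖ω‖ := by positivity
  rw [← ENNReal.mul_rpow_of_nonneg _ _ hr.le, jb2_phaseEquiv, ENNReal.iSup_mul]
  calc _ ≤ ENNReal.ofReal (C * (1 + ‖ω‖) ^ (-(((finrank ℝ (PhaseSpace d) : ℝ) + 1) / r))) ^ r := by
        refine ENNReal.rpow_le_rpow (iSup_le fun x => ?_) hr.le
        obtain ⟨x, rfl⟩ := (phaseEquiv d).surjective x
        have hx := japBracket_pos x
        rw [stft2_term_eq, ← ENNReal.ofReal_mul (by positivity)]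
        exact ENNReal.ofReal_le_ofReal (hC x ω)
    _ = _ := by
        rw [ENNReal.ofReal_rpow_of_nonneg (by positivity) hr.le,
          Real.mul_rpow hC0 (by positivity), ← Real.rpow_mul hω0.le, neg_mul,
          div_mul_cancel₀ _ hr.ne']

lemma rapidDecay_of_mpd2_bounds {m : ℝ} {G : 𝓢((Fin d → ℝ) × (Fin d → ℝ), ℂ)}
    {σ : (Fin d → ℝ) × (Fin d → ℝ) → ℂ} (hσ : ContDiff ℝ (⊤ : ℕ∞) σ)
    (h : ∀ α : (Fin d → ℕ) × (Fin d → ℕ), ∃ C : ℝ, ∀ z, ‖mpd2 α σ z‖ ≤ C * jb2 z ^ m) :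
    RapidDecay (σ ∘ phaseEquiv d) (phaseWindow G) fun x => japBracket x ^ m := by
  refine rapidDecay_of_pdir_bounds (EuclideanSpace.basisFun (Fin d ⊕ Fin d) ℝ)
    (isModerate_japBracket_rpow m) (hσ.comp (phaseEquiv d).contDiff) (fun i k => ?_) ?_ _
  · rw [EuclideanSpace.basisFun_apply]
    rcases i with i | i
    · obtain ⟨C, hC⟩ := h (Pi.single i k, 0)
      refine ⟨C, fun z => ?_⟩
      rw [iterate_pdir_single_inl, ← jb2_phaseEquiv]
      exact hC _
    · obtain ⟨C, hC⟩ := h (0, Pi.single i k)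
      refine ⟨C, fun z => ?_⟩
      rw [iterate_pdir_single_inr, ← jb2_phaseEquiv]
      exact hC _
  · obtain ⟨C, hC⟩ := h 0
    refine ⟨C, fun z => ?_⟩
    have h0 : mpd2 0 σ = σ := by
      simp [mpd2, stdList2, stdList_zero, mpdList]
    rw [h0] at hC
    rw [← jb2_phaseEquiv]
    exact hC _

lemma exists_norm_mpd2_le {m : ℝ} {σ : (Fin d → ℝ) × (Fin d → ℝ) → ℂ}
    (hσ : ContDiff ℝ (⊤ : ℕ∞) σ)
    (h : ∀ n, ∃ C : ℝ, ∀ z, ‖iteratedFDeriv ℝ n (σ ∘ phaseEquiv d) z‖ ≤ C * japBracket z ^ m)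
    (α : (Fin d → ℕ) × (Fin d → ℕ)) : ∃ C : ℝ, ∀ z, ‖mpd2 α σ z‖ ≤ C * jb2 z ^ m := by
  set vs := (stdList2 d α).map (phaseEquiv d).symm with hvs
  obtain ⟨C, hC⟩ := h vs.length
  refine ⟨C * ∏ i, ‖vs.get i‖, fun z => ?_⟩
  obtain ⟨z, rfl⟩ := (phaseEquiv d).surjective z
  have e : mpd2 α σ (phaseEquiv d z) = mpdList vs (σ ∘ phaseEquiv d) z := by
    rw [mpdList_comp_equiv, hvs, List.map_map]
    simp [mpd2]
  rw [e, jb2_phaseEquiv, mul_right_comm]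
  exact (norm_mpdList_le (hσ.comp (phaseEquiv d).contDiff) vs z).trans (by gcongr; exact hC z)

lemma exists_norm_mpd2_le_of_modNorm {m : ℝ} {q : ℝ≥0∞} (hq : q ≠ 0)
    {G : 𝓢((Fin d → ℝ) × (Fin d → ℝ), ℂ)} (hG : G ≠ 0)
    {σ : (Fin d → ℝ) × (Fin d → ℝ) → ℂ} (hσ : ContDiff ℝ (⊤ : ℕ∞) σ)
    (hσtemp : ∃ C k : ℝ, ∀ z, ‖σ z‖ ≤ C * jb2 z ^ k)
    (h : ∀ s : ℝ, 0 ≤ s → modNorm q m s G σ < ⊤) (α : (Fin d → ℕ) × (Fin d → ℕ)) :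
    ∃ C : ℝ, ∀ z, ‖mpd2 α σ z‖ ≤ C * jb2 z ^ m := by
  have hτ : ContDiff ℝ (⊤ : ℕ∞) (σ ∘ phaseEquiv d) := hσ.comp (phaseEquiv d).contDiff
  have hm := isModerate_japBracket_rpow (V := PhaseSpace d) m
  obtain ⟨C₀, k, hk⟩ := hσtemp
  have hk' (z : PhaseSpace d) : ‖(σ ∘ phaseEquiv d) z‖ ≤ C₀ * japBracket z ^ k := by
    rw [← jb2_phaseEquiv]
    exact hk _
  have hC₀ : 0 ≤ C₀ := nonneg_of_mul_nonneg_left ((norm_nonneg _).trans (hk' 0))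
    (Real.rpow_pos_of_pos (japBracket_pos 0) k)
  have hQ : RapidDecay (σ ∘ phaseEquiv d) (phaseWindow G) fun x => japBracket x ^ m := by
    by_cases hq' : q = ∞
    · subst hq'
      exact rapidDecay_of_modNorm_top_lt_top h
    · have hr : 0 < q.toReal := ENNReal.toReal_pos hq hq'
      have hlp := lpDecay_of_modNorm_lt_top hq hq' h
      obtain ⟨C, hC⟩ := hlp.exists_norm_le hr hτ.continuous (phaseWindow_ne_zero hG) hk'
      exact hlp.rapidDecay hr hτ.continuous hm hC
  obtain ⟨y₀, hy₀⟩ : ∃ y₀, phaseWindow G y₀ ≠ 0 := by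
    by_contra! h0
    exact phaseWindow_ne_zero hG (SchwartzMap.ext h0)
  exact exists_norm_mpd2_le hσ (exists_norm_iteratedFDeriv_le_of_rapidDecay hτ hy₀ hm
    (integrable_localized hτ.continuous (isModerate_japBracket_rpow k) hC₀ hk' _) hQ) α

end PhaseSpace

open scoped ENNReal in
/-- Characterization of `S^m(ℝ^{2d})`: a smooth (tempered) function `σ` belongs to
`S^m(ℝ^{2d})` iff `σ ∈ M^{∞,q}_{⟨·⟩^{-m} ⊗ ⟨·⟩^s}(ℝ^{2d})` for every `s ≥ 0`. -/
theorem Sm_eq_intersection_modulation (d : ℕ) (m : ℝ) (q : ℝ≥0∞) (hq : q ≠ 0)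
    (G : SchwartzMap ((Fin d → ℝ) × (Fin d → ℝ)) ℂ) (hG : G ≠ 0)
    (σ : (Fin d → ℝ) × (Fin d → ℝ) → ℂ) (hσ : ContDiff ℝ (⊤ : ℕ∞) σ)
    (hσtemp : ∃ C k : ℝ, ∀ z, ‖σ z‖ ≤ C * jb2 z ^ k) :
    (∀ α : (Fin d → ℕ) × (Fin d → ℕ), ∃ C : ℝ, ∀ z, ‖mpd2 α σ z‖ ≤ C * jb2 z ^ m) ↔
      (∀ s : ℝ, 0 ≤ s → modNorm q m s (⇑G) σ < ⊤) := by
  exact ⟨fun h s hs => modNorm_lt_top_of_rapidDecay hq (rapidDecay_of_mpd2_bounds hσ h) hs,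
    exists_norm_mpd2_le_of_modNorm hq hG hσ hσtemp⟩
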